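/- Let P, P', Q, Q' ∈ ℂ. If the compositions ρ_{Q,2π/3} ∘ ρ_{P,4π/3} and ρ_{Q',2π/3} ∘ ρ_{P',4π/3} are equal as maps ℂ → ℂ, then |P − Q| = |P' − Q'|. -/

import Mathlib

open Real Complex

/-- Rotation of the Euclidean plane (identified with `ℂ`) by angle `θ` about the point `P`. -/
noncomputable def planeRotation (P : ℂ) (θ : ℝ) : ℂ → ℂ :=
  fun z => P + Complex.exp (θ * Complex.I) * (z - P)

theorem holonomy_equal_implies_equidistant (P P' Q Q' : ℂ)
    (h : ∀ z : ℂ, planeRotation Q (2 * π / 3) (planeRotation P (4 * π / 3) z)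
        = planeRotation Q' (2 * π / 3) (planeRotation P' (4 * π / 3) z)) :
    ‖P - Q‖ = ‖P' - Q'‖ := by
  have e2 : Complex.exp (((4 * π / 3 : ℝ) : ℂ) * Complex.I)
      = Complex.exp (((2 * π / 3 : ℝ) : ℂ) * Complex.I) ^ 2 := by
    rw [← Complex.exp_nat_mul]
    congr 1
    push_cast
    ring
  have e3 : Complex.exp (((2 * π / 3 : ℝ) : ℂ) * Complex.I) ^ 3 = 1 := by
    rw [← Complex.exp_nat_mul, ← Complex.exp_two_pi_mul_I]
    congr 1
    push_cast
    ring
  have e1 : Complex.exp (((2 * π / 3 : ℝ) : ℂ) * Complex.I) ≠ 1 := by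
    intro hw
    have him := congrArg Complex.im hw
    rw [Complex.exp_ofReal_mul_I_im, Complex.one_im] at him
    have hpos := Real.sin_pos_of_pos_of_lt_pi (x := 2 * π / 3)
      (by linarith [Real.pi_pos]) (by linarith [Real.pi_pos])
    linarith
  have h0 := h 0
  simp only [planeRotation, e2] at h0
  generalize Complex.exp (((2 * π / 3 : ℝ) : ℂ) * Complex.I) = w at *
  have key : (1 - w) * ((P - Q) - (P' - Q')) = 0 := by
    linear_combination -h0 + (P' - P) * e3
  have hz := (mul_eq_zero.mp key).resolve_left (sub_ne_zero.mpr (Ne.symm e1))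
  rw [sub_eq_zero.mp hz]
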